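/- arXiv:2108.13685 — 8 statements merged into one kernel-verified Lean document; each statement's English description precedes it below -/
import Mathlib

section
/- Under the stated hypotheses, if additionally s := max_{1≤i≤n} sup_{x∈X} |s_i(x)| < 1, then there exists a unique bounded function ψ : X → F satisfying the system of functional equations ψ(l_i(x)) = q_i(x) + s_i(x) · ψ(x) for all x ∈ X and all i = 1,…,n. -/
open BoundedContinuousFunction in
/-- An affine functional equation `f y = b y + a y • f (τ y)` with bounded inhomogeneity `b` and
uniformly contractive coefficient `a` has exactly one bounded solution. -/
theorem existsUnique_bounded_eq_add_smul_comp {α F : Type*}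
    [NormedAddCommGroup F] [NormedSpace ℝ F] [CompleteSpace F]
    (τ : α → α) (a : α → ℝ) (b : α → F) {c M : ℝ} (hc : c < 1)
    (ha : ∀ y, |a y| ≤ c) (hb : ∀ y, ‖b y‖ ≤ M) :
    ∃! f : α → F, (∃ C : ℝ, ∀ y, ‖f y‖ ≤ C) ∧ ∀ y, f y = b y + a y • f (τ y) := by
  let _ : TopologicalSpace α := ⊥
  have : DiscreteTopology α := ⟨rfl⟩
  have hac (y : α) : ‖a y‖ ≤ c.toNNReal := (ha y).trans (Real.le_coe_toNNReal c)
  let T (f : α →ᵇ F) : α →ᵇ F :=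
    ofNormedAddCommGroupDiscrete (fun y => b y + a y • f (τ y)) (M + c.toNNReal * ‖f‖) fun y => by
      refine norm_add_le_of_le (hb y) ?_
      rw [norm_smul]
      exact mul_le_mul (hac y) (f.norm_coe_le_norm _) (norm_nonneg _) (NNReal.coe_nonneg _)
  have hT (f : α →ᵇ F) (y : α) : T f y = b y + a y • f (τ y) := rfl
  have hcontr : ContractingWith c.toNNReal T := by
    refine ⟨by simpa using hc, LipschitzWith.of_dist_le_mul fun f g => ?_⟩
    refine (dist_le (by positivity)).2 fun y => ?_
    rw [hT, hT, dist_add_left, dist_smul₀]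
    exact mul_le_mul (hac y) (dist_coe_le_dist _) dist_nonneg (NNReal.coe_nonneg _)
  refine ⟨(hcontr.fixedPoint T : α →ᵇ F), ⟨⟨_, norm_coe_le_norm _⟩, fun y => ?_⟩, ?_⟩
  · rw [← hT, hcontr.fixedPoint_isFixedPt]
  · rintro f ⟨⟨C, hC⟩, hf⟩
    have hfix : Function.IsFixedPt T (ofNormedAddCommGroupDiscrete f C hC) :=
      BoundedContinuousFunction.ext fun y => (hf y).symm
    exact congrArg DFunLike.coe (hcontr.fixedPoint_unique hfix)

/-- **Global fractal interpolation, bounded solutions.**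
Let `E` be a real normed space, `X` a nonempty bounded subset of `E`, and `n ≥ 1`.
Let `l 1, …, l n : X → X` be injective maps with pairwise disjoint images covering `X`.
Let `F` be a real Banach space, and for each `i` let `s i : X → ℝ` and `q i : X → F` be
bounded functions.  If `max_i sup_x |s i x| < 1` (i.e. there is a common bound `c < 1`),
then there is a unique bounded `ψ : X → F` with
`ψ (l i x) = q i x + s i x • ψ x` for all `x ∈ X` and all `i`. -/
theorem stmt0 {E F : Type*} [NormedAddCommGroup E] [NormedSpace ℝ E]
    [NormedAddCommGroup F] [NormedSpace ℝ F] [CompleteSpace F]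
    (X : Set E) (hXne : X.Nonempty) (hXbd : Bornology.IsBounded X)
    (n : ℕ) (hn : 0 < n)
    (l : Fin n → X → X) (hinj : ∀ i, Function.Injective (l i))
    (hdisj : ∀ i j, i ≠ j → Disjoint (Set.range (l i)) (Set.range (l j)))
    (hcover : ∀ y : X, ∃ i, y ∈ Set.range (l i))
    (s : Fin n → X → ℝ) (q : Fin n → X → F)
    (hqbd : ∀ i, ∃ M : ℝ, ∀ x, ‖q i x‖ ≤ M)
    (hs : ∃ c : ℝ, c < 1 ∧ ∀ i x, |s i x| ≤ c) :
    ∃! ψ : X → F, (∃ M : ℝ, ∀ x, ‖ψ x‖ ≤ M) ∧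
      ∀ i x, ψ (l i x) = q i x + s i x • ψ x := by
  obtain ⟨c, hc, hsc⟩ := hs
  choose M hM using hqbd
  have hbij : Function.Bijective fun p : Fin n × X => l p.1 p.2 := by
    refine ⟨?_, fun y => ?_⟩
    · rintro ⟨i, x⟩ ⟨j, y⟩ (h : l i x = l j y)
      obtain rfl : i = j := by
        by_contra hij
        exact Set.disjoint_left.1 (hdisj i j hij) ⟨x, rfl⟩ ⟨y, h.symm⟩
      rw [hinj i h]
    · obtain ⟨i, x, hx⟩ := hcover y
      exact ⟨(i, x), hx⟩
  let e : Fin n × X ≃ X := Equiv.ofBijective _ hbij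
  have hq (p : Fin n × X) : ‖q p.1 p.2‖ ≤ ∑ i, |M i| :=
    (hM p.1 p.2).trans <| (le_abs_self _).trans <|
      Finset.single_le_sum (f := fun i => |M i|) (fun _ _ => abs_nonneg _) (Finset.mem_univ p.1)
  have hequiv (ψ : X → F) :
      (∀ y, ψ y = q (e.symm y).1 (e.symm y).2 + s (e.symm y).1 (e.symm y).2 • ψ (e.symm y).2) ↔
        ∀ i x, ψ (l i x) = q i x + s i x • ψ x := by
    rw [← e.forall_congr_right, Prod.forall]
    simp only [Equiv.symm_apply_apply]
    rfl
  simpa only [hequiv] using existsUnique_bounded_eq_add_smul_comp (fun y => (e.symm y).2)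
    (fun y => s (e.symm y).1 (e.symm y).2) (fun y => q (e.symm y).1 (e.symm y).2) hc
    (fun y => hsc _ _) (fun y => hq (e.symm y))
end

section
/- Under the stated local hypotheses, if s := max_{1≤i≤n} sup_{x∈X_i} |s_i(x)| < 1, then there exists a unique bounded function ψ : X → F satisfying ψ(l_i(x)) = q_i(x) + s_i(x) · ψ(x) for all x ∈ X_i and all i = 1,…,n. -/
/-- The affine functional equation `ψ y = Q y + S y • ψ (g y)` has a bounded solution when `Q` is
bounded and `|S|` is bounded by a constant less than `1`. -/
theorem exists_bounded_solution_affine_functional_equation {α F : Type*} [NormedAddCommGroup F]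
    [NormedSpace ℝ F] [CompleteSpace F] (g : α → α) (S : α → ℝ) (Q : α → F) {c M : ℝ}
    (hc0 : 0 ≤ c) (hc1 : c < 1) (hS : ∀ y, |S y| ≤ c) (hQ : ∀ y, ‖Q y‖ ≤ M) :
    ∃ ψ : α → F, (∃ B : ℝ, ∀ y, ‖ψ y‖ ≤ B) ∧ ∀ y, ψ y = Q y + S y • ψ (g y) := by
  let u : ℕ → α → F := fun k => Nat.rec Q (fun _ v y => S y • v (g y)) k
  have hu : ∀ k y, ‖u k y‖ ≤ M * c ^ k := by
    intro k
    induction k with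
    | zero => simpa [u] using hQ
    | succ k ih =>
      intro y
      calc ‖S y • u k (g y)‖ = |S y| * ‖u k (g y)‖ := by rw [norm_smul, Real.norm_eq_abs]
        _ ≤ c * (M * c ^ k) := mul_le_mul (hS y) (ih _) (norm_nonneg _) hc0
        _ = M * c ^ (k + 1) := by ring
  have hgeom : HasSum (fun k : ℕ => M * c ^ k) (M * (1 - c)⁻¹) :=
    (hasSum_geometric_of_lt_one hc0 hc1).mul_left M
  have hsum : ∀ y, Summable fun k => u k y := fun y =>
    .of_norm_bounded hgeom.summable fun k => hu k y
  refine ⟨fun y => ∑' k, u k y, ⟨M * (1 - c)⁻¹, fun y =>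
    tsum_of_norm_bounded hgeom fun k => hu k y⟩, fun y => ?_⟩
  change ∑' k, u k y = Q y + S y • ∑' k, u k (g y)
  rw [(hsum y).tsum_eq_zero_add, ← (hsum (g y)).tsum_const_smul]
  rfl

/-- A function that is bounded on `X` and satisfies `‖d y‖ ≤ c * ‖d x‖` for some `x ∈ X`, for every
`y ∈ X`, vanishes on `X` when `c < 1`. -/
theorem eq_zero_on_of_bounded_of_norm_le_mul {α F : Type*} [NormedAddCommGroup F]
    {X : Set α} {d : α → F} {c B : ℝ} (hc0 : 0 ≤ c) (hc1 : c < 1) (hB : ∀ y ∈ X, ‖d y‖ ≤ B)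
    (hd : ∀ y ∈ X, ∃ x ∈ X, ‖d y‖ ≤ c * ‖d x‖) : ∀ y ∈ X, d y = 0 := by
  have hk : ∀ k : ℕ, ∀ y ∈ X, ‖d y‖ ≤ c ^ k * B := by
    intro k
    induction k with
    | zero => simpa using hB
    | succ k ih =>
      intro y hy
      obtain ⟨x, hx, hyx⟩ := hd y hy
      calc ‖d y‖ ≤ c * ‖d x‖ := hyx
        _ ≤ c * (c ^ k * B) := mul_le_mul_of_nonneg_left (ih x hx) hc0
        _ = c ^ (k + 1) * B := by ring
  intro y hy
  have hlim : Filter.Tendsto (fun k : ℕ => c ^ k * B) Filter.atTop (nhds 0) := by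
    simpa using (tendsto_pow_atTop_nhds_zero_of_lt_one hc0 hc1).mul_const B
  exact norm_le_zero_iff.mp (ge_of_tendsto' hlim fun k => hk k y hy)


/-- **Local fractal interpolation, bounded solutions.**
Let `X` be a nonempty subset of a real normed space `E`, let `Xi 1, …, Xi n` be nonempty
subsets of `X`, and let `l i` be maps injective on `Xi i` (not necessarily contractive)
whose images `l i '' Xi i` are pairwise disjoint with union `X`.  Let `F` be a real
Banach space and `s i : Xi i → ℝ`, `q i : Xi i → F` bounded.  If there is `c < 1` with
`|s i x| ≤ c` on `Xi i` for all `i`, then there is a function `ψ : X → F`, bounded on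
`X`, satisfying `ψ (l i x) = q i x + s i x • ψ x` for all `x ∈ Xi i` and all `i`, and
`ψ` is unique on `X` among bounded solutions. -/
theorem stmt4 {E F : Type*} [NormedAddCommGroup E] [NormedSpace ℝ E]
    [NormedAddCommGroup F] [NormedSpace ℝ F] [CompleteSpace F]
    (X : Set E) (hXne : X.Nonempty)
    (n : ℕ) (hn : 0 < n)
    (Xi : Fin n → Set E) (hXine : ∀ i, (Xi i).Nonempty) (hXisub : ∀ i, Xi i ⊆ X)
    (l : Fin n → E → E) (hinj : ∀ i, Set.InjOn (l i) (Xi i))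
    (hdisj : ∀ i j, i ≠ j → Disjoint (l i '' Xi i) (l j '' Xi j))
    (hcover : X = ⋃ i, l i '' Xi i)
    (s : Fin n → E → ℝ) (q : Fin n → E → F)
    (hqbd : ∀ i, ∃ M : ℝ, ∀ x ∈ Xi i, ‖q i x‖ ≤ M)
    (hs : ∃ c : ℝ, c < 1 ∧ ∀ i, ∀ x ∈ Xi i, |s i x| ≤ c) :
    ∃ ψ : E → F,
      ((∃ M : ℝ, ∀ x ∈ X, ‖ψ x‖ ≤ M) ∧
        ∀ i, ∀ x ∈ Xi i, ψ (l i x) = q i x + s i x • ψ x) ∧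
      ∀ φ : E → F,
        ((∃ M : ℝ, ∀ x ∈ X, ‖φ x‖ ≤ M) ∧
          ∀ i, ∀ x ∈ Xi i, φ (l i x) = q i x + s i x • φ x) →
        Set.EqOn φ ψ X := by
  obtain ⟨c, hc1, hc⟩ := hs
  choose M₀ hM₀ using hqbd
  obtain ⟨M, hM⟩ := (Set.finite_range M₀).bddAbove
  have hq : ∀ i, ∀ x ∈ Xi i, ‖q i x‖ ≤ M := fun i x hx => (hM₀ i x hx).trans (hM ⟨i, rfl⟩)
  obtain ⟨x₀, hx₀⟩ := hXine ⟨0, hn⟩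
  have hc0 : 0 ≤ c := (abs_nonneg _).trans (hc _ x₀ hx₀)
  have hM0 : 0 ≤ M := (norm_nonneg _).trans (hq _ x₀ hx₀)
  have hdata : ∀ y, ∃ (g : E) (S : ℝ) (Q : F), |S| ≤ c ∧ ‖Q‖ ≤ M ∧
      ∀ i, ∀ x ∈ Xi i, l i x = y → g = x ∧ S = s i x ∧ Q = q i x := by
    intro y
    by_cases hy : ∃ i, ∃ x ∈ Xi i, l i x = y
    · obtain ⟨i, x, hx, rfl⟩ := hy
      refine ⟨x, s i x, q i x, hc i x hx, hq i x hx, fun j z hz hzx => ?_⟩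
      obtain rfl : i = j := by
        by_contra hij
        exact Set.disjoint_left.mp (hdisj i j hij) ⟨x, hx, rfl⟩ ⟨z, hz, hzx⟩
      obtain rfl := hinj i hz hx hzx
      exact ⟨rfl, rfl, rfl⟩
    · exact ⟨y, 0, 0, by simpa using hc0, by simpa using hM0,
        fun i x hx hxy => (hy ⟨i, x, hx, hxy⟩).elim⟩
  choose g S Q hS hQ hgSQ using hdata
  obtain ⟨ψ, ⟨B, hB⟩, hψ⟩ :=
    exists_bounded_solution_affine_functional_equation g S Q hc0 hc1 hS hQ
  have hψl : ∀ i, ∀ x ∈ Xi i, ψ (l i x) = q i x + s i x • ψ x := by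
    intro i x hx
    obtain ⟨h₁, h₂, h₃⟩ := hgSQ (l i x) i x hx rfl
    rw [hψ, h₁, h₂, h₃]
  refine ⟨ψ, ⟨⟨B, fun y _ => hB y⟩, hψl⟩, ?_⟩
  rintro φ ⟨⟨C, hC⟩, hφl⟩ y hy
  refine sub_eq_zero.mp (eq_zero_on_of_bounded_of_norm_le_mul (d := fun y => φ y - ψ y)
    (B := C + B) hc0 hc1 (fun y hy => norm_sub_le_of_le (hC y hy) (hB y)) (fun y hy => ?_) y hy)
  rw [hcover] at hy
  obtain ⟨i, x, hx, rfl⟩ := Set.mem_iUnion.mp hy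
  refine ⟨x, hXisub i hx, ?_⟩
  simp only [hφl i x hx, hψl i x hx, add_sub_add_left_eq_sub, ← smul_sub, norm_smul,
    Real.norm_eq_abs]
  exact mul_le_mul_of_nonneg_right (hc i x hx) (norm_nonneg _)
end

section
/- Assume the endpoint conditions q_{2j−1}((2j−2)/n) + (s_{2j−1}((2j−2)/n) − 1)·y_{j−1} = 0 and q_{2j}(2j/n) + (s_{2j}(2j/n) − 1)·y_j = 0, and the join-up conditions q_{2j}((2j−2)/n) + s_{2j}((2j−2)/n)·y_{j−1} = q_{2j−1}(2j/n) + s_{2j−1}(2j/n)·y_j, for all j = 1,…,n/2. Then for every f ∈ C_Δ the prescription Tf(l_i(t)) = q_i(t) + s_i(t)·f(t) for t ∈ X_i, i = 1,…,n, yields a well-defined continuous function Tf : [0,1] → ℝ (the two prescriptions agree at each interior knot i/n), and Tf ∈ C_Δ, i.e. Tf(2j/n) = y_j for all j = 0,…,n/2. -/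
/-- Continuous pieces on consecutive intervals which agree at the common knots glue to a
continuous function. -/
theorem exists_continuousOn_eqOn_of_knots {a : ℕ → ℝ} (ha : Monotone a) (g : ℕ → ℝ → ℝ)
    (N : ℕ) (hg : ∀ i < N, ContinuousOn (g i) (Set.Icc (a i) (a (i + 1))))
    (hag : ∀ i, i + 1 < N → g i (a (i + 1)) = g (i + 1) (a (i + 1))) :
    ∃ F : ℝ → ℝ, ContinuousOn F (Set.Icc (a 0) (a N)) ∧
      ∀ i < N, Set.EqOn F (g i) (Set.Icc (a i) (a (i + 1))) := by
  induction N with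
  | zero => exact ⟨g 0, by simp, by simp⟩
  | succ N ih =>
    rcases Nat.eq_zero_or_pos N with rfl | hN
    · refine ⟨g 0, hg 0 (by simp), fun i hi => ?_⟩
      obtain rfl : i = 0 := by omega
      exact Set.eqOn_refl _ _
    obtain ⟨F, hF, hFg⟩ := ih (fun i hi => hg i (by omega)) (fun i hi => hag i (by omega))
    have hknot : F (a N) = g N (a N) := by
      obtain ⟨k, rfl⟩ : ∃ k, N = k + 1 := ⟨N - 1, by omega⟩
      rw [hFg k (by omega) ⟨ha (by omega), le_rfl⟩, hag k (by omega)]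
    set G : ℝ → ℝ := fun x => if x ≤ a N then F x else g N x with hG
    have hGF : Set.EqOn G F (Set.Icc (a 0) (a N)) := fun x hx => if_pos hx.2
    have hGg : Set.EqOn G (g N) (Set.Icc (a N) (a (N + 1))) := fun x hx => by
      by_cases h : x ≤ a N
      · obtain rfl : x = a N := le_antisymm h hx.1
        simp [hG, hknot]
      · exact if_neg h
    refine ⟨G, ?_, fun i hi => ?_⟩
    · rw [← Set.Icc_union_Icc_eq_Icc (ha (Nat.zero_le N)) (ha (Nat.le_succ N))]
      exact (hF.congr hGF).union_of_isClosed ((hg N (by omega)).congr hGg) isClosed_Icc isClosed_Icc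
    · rcases Nat.lt_succ_iff_lt_or_eq.mp hi with h | rfl
      · exact fun x hx => (hGF ⟨(ha (Nat.zero_le i)).trans hx.1, hx.2.trans (ha h)⟩).trans
          (hFg i h hx)
      · exact hGg

/-- **Well-definedness and continuity of the local RB operator on `C_Δ`.**
Let `n = 2m` be a positive even integer, with `X (2j−1) = X (2j) = [(2j−2)/n, 2j/n]`,
`l (2j−1) t = t/2 + (j−1)/n` and `l (2j) t = t/2 + j/n`, interpolation values
`y 0, …, y m`, and continuous `q i, s i : X i → ℝ`.  Assume the endpoint conditions
`q (2j−1) ((2j−2)/n) + (s (2j−1) ((2j−2)/n) − 1) * y (j−1) = 0`,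
`q (2j) (2j/n) + (s (2j) (2j/n) − 1) * y j = 0`, and the join-up conditions
`q (2j) ((2j−2)/n) + s (2j) ((2j−2)/n) * y (j−1)
  = q (2j−1) (2j/n) + s (2j−1) (2j/n) * y j` for `j = 1, …, m`.
Then for every `f ∈ C_Δ` the prescriptions `Tf (l i t) = q i t + s i t * f t`
(`t ∈ X i`) yield a well-defined continuous function `Tf` on `[0,1]` with
`Tf (2j/n) = y j` for `j = 0, …, m`. -/
theorem stmt7 (m : ℕ) (hm : 0 < m)
    (y : ℕ → ℝ) (q s : ℕ → ℝ → ℝ)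
    (hqc : ∀ j, 1 ≤ j → j ≤ m →
      ContinuousOn (q (2 * j - 1))
        (Set.Icc ((2 * (j : ℝ) - 2) / (2 * m)) ((2 * (j : ℝ)) / (2 * m))) ∧
      ContinuousOn (q (2 * j))
        (Set.Icc ((2 * (j : ℝ) - 2) / (2 * m)) ((2 * (j : ℝ)) / (2 * m))))
    (hsc : ∀ j, 1 ≤ j → j ≤ m →
      ContinuousOn (s (2 * j - 1))
        (Set.Icc ((2 * (j : ℝ) - 2) / (2 * m)) ((2 * (j : ℝ)) / (2 * m))) ∧
      ContinuousOn (s (2 * j))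
        (Set.Icc ((2 * (j : ℝ) - 2) / (2 * m)) ((2 * (j : ℝ)) / (2 * m))))
    (hend1 : ∀ j, 1 ≤ j → j ≤ m →
      q (2 * j - 1) ((2 * (j : ℝ) - 2) / (2 * m)) +
        (s (2 * j - 1) ((2 * (j : ℝ) - 2) / (2 * m)) - 1) * y (j - 1) = 0)
    (hend2 : ∀ j, 1 ≤ j → j ≤ m →
      q (2 * j) ((2 * (j : ℝ)) / (2 * m)) +
        (s (2 * j) ((2 * (j : ℝ)) / (2 * m)) - 1) * y j = 0)
    (hjoin : ∀ j, 1 ≤ j → j ≤ m →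
      q (2 * j) ((2 * (j : ℝ) - 2) / (2 * m)) +
          s (2 * j) ((2 * (j : ℝ) - 2) / (2 * m)) * y (j - 1) =
        q (2 * j - 1) ((2 * (j : ℝ)) / (2 * m)) +
          s (2 * j - 1) ((2 * (j : ℝ)) / (2 * m)) * y j) :
    ∀ f : ℝ → ℝ, ContinuousOn f (Set.Icc (0 : ℝ) 1) →
      (∀ j ≤ m, f ((2 * (j : ℝ)) / (2 * m)) = y j) →
      ∃ Tf : ℝ → ℝ, ContinuousOn Tf (Set.Icc (0 : ℝ) 1) ∧
        (∀ j, 1 ≤ j → j ≤ m →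
          ∀ t ∈ Set.Icc ((2 * (j : ℝ) - 2) / (2 * m)) ((2 * (j : ℝ)) / (2 * m)),
            Tf (t / 2 + ((j : ℝ) - 1) / (2 * m)) =
              q (2 * j - 1) t + s (2 * j - 1) t * f t ∧
            Tf (t / 2 + (j : ℝ) / (2 * m)) = q (2 * j) t + s (2 * j) t * f t) ∧
        (∀ j ≤ m, Tf ((2 * (j : ℝ)) / (2 * m)) = y j) := by
  intro f hf hfy
  have hm' : (0 : ℝ) < m := by exact_mod_cast hm
  have hlo (k : ℕ) : (2 * ((k + 1 : ℕ) : ℝ) - 2) / (2 * m) = k / m := by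
    push_cast; field_simp; ring
  have hhi (k : ℕ) : (2 * (k : ℝ)) / (2 * m) = k / m := by field_simp
  have hsub (k : ℕ) : 2 * (k + 1) - 1 = 2 * k + 1 := by omega
  set p : ℕ → ℝ → ℝ := fun i t => q i t + s i t * f t with hp
  have hfy' (k : ℕ) (hk : k ≤ m) : f (k / m) = y k := by rw [← hfy k hk, hhi]
  have hleft (k : ℕ) (hk : k < m) : p (2 * k + 1) (k / m) = y k := by
    have h := hend1 (k + 1) (by omega) hk
    rw [hlo, hsub, Nat.add_sub_cancel] at h
    simp only [hp, hfy' k hk.le]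
    linarith
  have hright (k : ℕ) (hk : k < m) : p (2 * k + 2) ((k + 1 : ℕ) / m) = y (k + 1) := by
    have h := hend2 (k + 1) (by omega) hk
    rw [hhi] at h
    simp only [hp, hfy' (k + 1) hk]
    linarith!
  have hmid (k : ℕ) (hk : k < m) :
      p (2 * k + 2) (k / m) = p (2 * k + 1) ((k + 1 : ℕ) / m) := by
    have h := hjoin (k + 1) (by omega) hk
    rw [hlo, hhi, hsub, Nat.add_sub_cancel] at h
    simp only [hp, hfy' k hk.le, hfy' (k + 1) hk]
    exact h
  have hpc (k : ℕ) (hk : k < m) :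
      ContinuousOn (p (2 * k + 1)) (Set.Icc (k / m) ((k + 1 : ℕ) / m)) ∧
      ContinuousOn (p (2 * k + 2)) (Set.Icc (k / m) ((k + 1 : ℕ) / m)) := by
    have h1 := hqc (k + 1) (by omega) hk
    have h2 := hsc (k + 1) (by omega) hk
    rw [hlo, hhi, hsub] at h1 h2
    have hf' : ContinuousOn f (Set.Icc (k / m) ((k + 1 : ℕ) / m)) := hf.mono <|
      Set.Icc_subset_Icc (by positivity) ((div_le_one hm').2 (by exact_mod_cast hk))
    exact ⟨h1.1.add (h2.1.mul hf'), h1.2.add (h2.2.mul hf')⟩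
  have ha : Monotone fun i : ℕ => (i : ℝ) / (2 * m) := fun i j hij => by
    dsimp only
    gcongr
  obtain ⟨F, hF, hFg⟩ := exists_continuousOn_eqOn_of_knots ha
    (fun i x => p (i + 1) (2 * x - ((i + 1) / 2 : ℕ) / m)) (2 * m) (fun i hi => by
      rcases Nat.even_or_odd' i with ⟨k, rfl | rfl⟩
      · refine (hpc k (by omega)).1.comp (by fun_prop) fun x hx => ?_
        rw [show (2 * k + 1) / 2 = k by omega]
        simp only [Set.mem_Icc, div_le_iff₀ (by positivity : (0 : ℝ) < 2 * m),
          le_div_iff₀ (by positivity : (0 : ℝ) < 2 * m), div_le_iff₀ hm',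
          le_div_iff₀ hm', sub_mul, div_mul_cancel₀ _ hm'.ne'] at hx ⊢
        push_cast at hx ⊢
        constructor <;> linarith
      · refine (hpc k (by omega)).2.comp (by fun_prop) fun x hx => ?_
        rw [show (2 * k + 1 + 1) / 2 = k + 1 by omega]
        simp only [Set.mem_Icc, div_le_iff₀ (by positivity : (0 : ℝ) < 2 * m),
          le_div_iff₀ (by positivity : (0 : ℝ) < 2 * m), div_le_iff₀ hm',
          le_div_iff₀ hm', sub_mul, div_mul_cancel₀ _ hm'.ne'] at hx ⊢
        push_cast at hx ⊢
        constructor <;> linarith) (fun i hi => by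
      rcases Nat.even_or_odd' i with ⟨k, rfl | rfl⟩
      · rw [show (2 * k + 1) / 2 = k by omega, show (2 * k + 1 + 1) / 2 = k + 1 by omega]
        convert (hmid k (by omega)).symm using 2 <;> push_cast <;> ring
      · rw [show (2 * k + 1 + 1) / 2 = k + 1 by omega,
          show (2 * k + 1 + 1 + 1) / 2 = k + 1 by omega]
        convert (hright k (by omega)).trans (hleft (k + 1) (by omega)).symm using 2 <;>
          push_cast <;> ring)
  have hT (k : ℕ) (hk : k < m) (t : ℝ) (ht : t ∈ Set.Icc ((k : ℝ) / m) ((k + 1 : ℕ) / m)) :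
      F (t / 2 + k / (2 * m)) = p (2 * k + 1) t ∧
      F (t / 2 + (k + 1 : ℕ) / (2 * m)) = p (2 * k + 2) t := by
    have hlower : (k : ℝ) / m = 2 * (k / (2 * m)) := by field_simp
    have hupper : ((k + 1 : ℕ) : ℝ) / m = 2 * (k / (2 * m)) + 2 * (1 / (2 * m)) := by
      push_cast; field_simp
    rw [hlower, hupper] at ht
    constructor
    · rw [hFg (2 * k) (by omega) ⟨?_, ?_⟩]
      · dsimp only
        rw [show (2 * k + 1) / 2 = k by omega]
        congr 1; field_simp; ring
      · push_cast
        linarith [ht.1, mul_div_assoc 2 (k : ℝ) (2 * m)]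
      · push_cast
        linarith [ht.2, mul_div_assoc 2 (k : ℝ) (2 * m), add_div (2 * (k : ℝ)) 1 (2 * m)]
    · rw [hFg (2 * k + 1) (by omega) ⟨?_, ?_⟩]
      · dsimp only
        rw [show (2 * k + 1 + 1) / 2 = k + 1 by omega]
        congr 1; field_simp; ring
      · push_cast
        linarith [ht.1, mul_div_assoc 2 (k : ℝ) (2 * m), add_div (2 * (k : ℝ)) 1 (2 * m),
          add_div (k : ℝ) 1 (2 * m)]
      · push_cast
        linarith [ht.2, mul_div_assoc 2 (k : ℝ) (2 * m), add_div (2 * (k : ℝ)) 1 (2 * m),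
          add_div (k : ℝ) 1 (2 * m), add_div (2 * (k : ℝ) + 1) 1 (2 * m)]
  have hle (k : ℕ) : (k : ℝ) / m ≤ (k + 1 : ℕ) / m := by
    gcongr
    omega
  refine ⟨F, ?_, fun j hj hjm t ht => ?_, fun j hj => ?_⟩
  · convert hF using 2
    · simp
    · push_cast; field_simp
  · obtain ⟨k, rfl⟩ : ∃ k, j = k + 1 := ⟨j - 1, by omega⟩
    rw [hlo, hhi] at ht
    rw [hsub, show ((k + 1 : ℕ) : ℝ) - 1 = k by push_cast; ring]
    exact hT k hjm t ht
  · rw [hhi]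
    rcases Nat.eq_zero_or_pos j with rfl | hj0
    · rw [← hleft 0 hm, ← (hT 0 hm _ ⟨le_rfl, hle 0⟩).1]
      simp
    · obtain ⟨k, rfl⟩ : ∃ k, j = k + 1 := ⟨j - 1, by omega⟩
      rw [← hright k hj, ← (hT k hj _ ⟨hle k, le_rfl⟩).2]
      congr 1; field_simp; ring
end

section
/- Assume the endpoint conditions q_{2j−1}((2j−2)/n) + (s_{2j−1}((2j−2)/n) − 1)·y_{j−1} = 0 and q_{2j}(2j/n) + (s_{2j}(2j/n) − 1)·y_j = 0, and the join-up conditions q_{2j}((2j−2)/n) + s_{2j}((2j−2)/n)·y_{j−1} = q_{2j−1}(2j/n) + s_{2j−1}(2j/n)·y_j, for all j = 1,…,n/2, and that max_{1≤i≤n} sup_{t∈X_i} |s_i(t)| < 1. Then there exists a unique continuous function ψ : [0,1] → ℝ such that ψ(2j/n) = y_j for all j = 0,…,n/2 and ψ(l_i(t)) = q_i(t) + s_i(t)·ψ(t) for all t ∈ X_i and all i = 1,…,n. -/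
open Set

theorem exists_eq_half_add_of_mem_Icc {a b x : ℝ} (hx : x ∈ Icc a b) :
    ∃ t ∈ Icc a b, x = (t + a) / 2 ∨ x = (t + b) / 2 := by
  obtain ⟨hax, hxb⟩ := hx
  rcases le_total x ((a + b) / 2) with h | h
  · exact ⟨2 * x - a, ⟨by linarith, by linarith⟩, Or.inl (by ring)⟩
  · exact ⟨2 * x - b, ⟨by linarith, by linarith⟩, Or.inr (by ring)⟩

theorem half_add_left_mem_Icc {a b t : ℝ} (ht : t ∈ Icc a b) : (t + a) / 2 ∈ Icc a b :=
  ⟨by linarith [ht.1], by linarith [ht.1, ht.2]⟩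

theorem half_add_right_mem_Icc {a b t : ℝ} (ht : t ∈ Icc a b) : (t + b) / 2 ∈ Icc a b :=
  ⟨by linarith [ht.1, ht.2], by linarith [ht.2]⟩

/-- Two continuous functions on `[a, b]` whose values match at the joint can be squeezed onto the
two halves of `[a, b]` and glued there. -/
theorem exists_continuousMap_glue_halves {a b : ℝ} (hab : a ≤ b) {F G : ℝ → ℝ}
    (hF : ContinuousOn F (Icc a b)) (hG : ContinuousOn G (Icc a b)) (hFG : F b = G a) :
    ∃ H : C(Icc a b, ℝ), ∀ (t : ℝ) (ht : t ∈ Icc a b),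
      H ⟨(t + a) / 2, half_add_left_mem_Icc ht⟩ = F t ∧
      H ⟨(t + b) / 2, half_add_right_mem_Icc ht⟩ = G t := by
  have hF' : Continuous (IccExtend hab ((Icc a b).domRestrict F)) := hF.domRestrict.Icc_extend'
  have hG' : Continuous (IccExtend hab ((Icc a b).domRestrict G)) := hG.domRestrict.Icc_extend'
  refine ⟨⟨fun x => IccExtend hab ((Icc a b).domRestrict F) (2 * x - a) +
    IccExtend hab ((Icc a b).domRestrict G) (2 * x - b) - G a, by fun_prop⟩, fun t ht => ⟨?_, ?_⟩⟩
  · rw [ContinuousMap.coe_mk]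
    rw [show 2 * ((t + a) / 2) - a = t by ring, IccExtend_of_mem _ _ ht,
      IccExtend_of_le_left _ _ (by linarith [ht.2])]
    simp
  · rw [ContinuousMap.coe_mk]
    rw [show 2 * ((t + b) / 2) - b = t by ring, IccExtend_of_mem _ _ ht,
      IccExtend_of_right_le _ _ (by linarith [ht.1])]
    simp [hFG]

theorem exists_continuous_fractal_interpolation {a b c u v : ℝ} (hab : a < b) (hc : c < 1)
    {q₁ q₂ s₁ s₂ : ℝ → ℝ}
    (hq₁ : ContinuousOn q₁ (Icc a b)) (hq₂ : ContinuousOn q₂ (Icc a b))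
    (hs₁ : ContinuousOn s₁ (Icc a b)) (hs₂ : ContinuousOn s₂ (Icc a b))
    (hleft : q₁ a + s₁ a * u = u) (hright : q₂ b + s₂ b * v = v)
    (hjoin : q₂ a + s₂ a * u = q₁ b + s₁ b * v)
    (hs : ∀ t ∈ Icc a b, |s₁ t| ≤ c ∧ |s₂ t| ≤ c) :
    ∃ f : ℝ → ℝ, Continuous f ∧ (∀ x ≤ a, f x = u) ∧ (∀ x, b ≤ x → f x = v) ∧
      ∀ t ∈ Icc a b, f ((t + a) / 2) = q₁ t + s₁ t * f t ∧
        f ((t + b) / 2) = q₂ t + s₂ t * f t := by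
  have ha : a ∈ Icc a b := left_mem_Icc.2 hab.le
  have hb : b ∈ Icc a b := right_mem_Icc.2 hab.le
  have hc0 : 0 ≤ c := (abs_nonneg _).trans (hs a ha).1
  let S : Set C(Icc a b, ℝ) := {g | g ⟨a, ha⟩ = u ∧ g ⟨b, hb⟩ = v}
  have hSclosed : IsClosed S :=
    (isClosed_eq (continuous_eval_const _) continuous_const).inter
      (isClosed_eq (continuous_eval_const _) continuous_const)
  have hT : ∀ g : S, ∃ H : S, ∀ (t : ℝ) (ht : t ∈ Icc a b),
      H.1 ⟨(t + a) / 2, half_add_left_mem_Icc ht⟩ = q₁ t + s₁ t * g.1 ⟨t, ht⟩ ∧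
      H.1 ⟨(t + b) / 2, half_add_right_mem_Icc ht⟩ = q₂ t + s₂ t * g.1 ⟨t, ht⟩ := by
    rintro ⟨g, hga, hgb⟩
    have hg : Continuous (IccExtend hab.le g) := g.continuous.Icc_extend'
    have hga' : IccExtend hab.le g a = u := by rw [IccExtend_of_mem _ _ ha, hga]
    have hgb' : IccExtend hab.le g b = v := by rw [IccExtend_of_mem _ _ hb, hgb]
    obtain ⟨H, hH⟩ := exists_continuousMap_glue_halves hab.le
      (hq₁.add (hs₁.mul hg.continuousOn)) (hq₂.add (hs₂.mul hg.continuousOn))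
      (by simp only [Pi.add_apply, Pi.mul_apply, hga', hgb', hjoin])
    refine ⟨⟨H, ?_, ?_⟩, fun t ht => ?_⟩
    · have h := (hH a ha).1
      simp only [add_self_div_two, Pi.add_apply, Pi.mul_apply, hga'] at h
      exact h.trans hleft
    · have h := (hH b hb).2
      simp only [add_self_div_two, Pi.add_apply, Pi.mul_apply, hgb'] at h
      exact h.trans hright
    · simpa only [Pi.add_apply, Pi.mul_apply, IccExtend_of_mem _ _ ht] using hH t ht
  choose T hT using hT
  have hcontr : ContractingWith ⟨c, hc0⟩ T := by
    refine ⟨by exact_mod_cast hc, LipschitzWith.of_dist_le_mul fun g h => ?_⟩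
    have key : ∀ (σ : ℝ) (t : Icc a b) (p : ℝ), |σ| ≤ c →
        dist (p + σ * g.1 t) (p + σ * h.1 t) ≤ c * dist g h := by
      intro σ t p hσ
      rw [dist_add_left, Real.dist_eq, ← mul_sub, abs_mul, ← Real.dist_eq]
      exact mul_le_mul hσ (ContinuousMap.dist_apply_le_dist t) dist_nonneg hc0
    refine (ContinuousMap.dist_le (mul_nonneg hc0 dist_nonneg)).2 ?_
    rintro ⟨x, hx⟩
    obtain ⟨t, ht, rfl | rfl⟩ := exists_eq_half_add_of_mem_Icc hx
    · rw [(hT g t ht).1, (hT h t ht).1]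
      exact key _ _ _ (hs t ht).1
    · rw [(hT g t ht).2, (hT h t ht).2]
      exact key _ _ _ (hs t ht).2
  obtain ⟨H, hH⟩ := exists_continuousMap_glue_halves (F := fun t => u + (t - a) / (b - a) * (v - u))
    (G := fun _ => v) hab.le (by fun_prop) (by fun_prop)
    (by rw [div_self (sub_pos.2 hab).ne']; ring)
  have hHS : H ∈ S := by
    constructor
    · simpa using (hH a ha).1
    · simpa using (hH b hb).2
  have : Nonempty S := ⟨⟨H, hHS⟩⟩
  have : CompleteSpace S := hSclosed.completeSpace_coe
  obtain ⟨g, hg⟩ : ∃ g, T g = g := ⟨_, hcontr.fixedPoint_isFixedPt⟩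
  refine ⟨IccExtend hab.le g.1, g.1.continuous.Icc_extend', fun x hx => ?_, fun x hx => ?_,
    fun t ht => ?_⟩
  · rw [IccExtend_of_le_left _ _ hx]
    exact g.2.1
  · rw [IccExtend_of_right_le _ _ hx]
    exact g.2.2
  · rw [IccExtend_of_mem _ _ ht, IccExtend_of_mem _ _ (half_add_left_mem_Icc ht),
      IccExtend_of_mem _ _ (half_add_right_mem_Icc ht)]
    have h := hT g t ht
    rwa [hg] at h

theorem eqOn_Icc_of_fractal_functional_equation {a b c : ℝ} (hab : a ≤ b) (hc : c < 1)
    {q₁ q₂ s₁ s₂ f g : ℝ → ℝ}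
    (hs : ∀ t ∈ Icc a b, |s₁ t| ≤ c ∧ |s₂ t| ≤ c)
    (hf : ContinuousOn f (Icc a b)) (hg : ContinuousOn g (Icc a b))
    (hf' : ∀ t ∈ Icc a b, f ((t + a) / 2) = q₁ t + s₁ t * f t ∧
      f ((t + b) / 2) = q₂ t + s₂ t * f t)
    (hg' : ∀ t ∈ Icc a b, g ((t + a) / 2) = q₁ t + s₁ t * g t ∧
      g ((t + b) / 2) = q₂ t + s₂ t * g t) :
    EqOn f g (Icc a b) := by
  obtain ⟨x, hx, hmax⟩ := isCompact_Icc.exists_isMaxOn (nonempty_Icc.2 hab) (hf.sub hg).abs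
  have hmax' : ∀ t ∈ Icc a b, |f t - g t| ≤ |f x - g x| := fun t ht => hmax ht
  have key : |f x - g x| ≤ c * |f x - g x| := by
    have step : ∀ (σ t p : ℝ), t ∈ Icc a b → |σ| ≤ c →
        |p + σ * f t - (p + σ * g t)| ≤ c * |f x - g x| := by
      intro σ t p ht hσ
      rw [add_sub_add_left_eq_sub, ← mul_sub, abs_mul]
      exact mul_le_mul hσ (hmax' t ht) (abs_nonneg _) ((abs_nonneg _).trans hσ)
    obtain ⟨t, ht, h | h⟩ := exists_eq_half_add_of_mem_Icc hx
    · nth_rewrite 1 [h]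
      nth_rewrite 1 [h]
      rw [(hf' t ht).1, (hg' t ht).1]
      exact step _ _ _ ht (hs t ht).1
    · nth_rewrite 1 [h]
      nth_rewrite 1 [h]
      rw [(hf' t ht).2, (hg' t ht).2]
      exact step _ _ _ ht (hs t ht).2
  intro t ht
  have h0 : |f x - g x| ≤ 0 := by nlinarith
  exact sub_eq_zero.1 (abs_nonpos_iff.1 ((hmax' t ht).trans h0))

/-- Continuous functions `f j`, constant to the left and to the right of `[p j, p (j + 1)]` with
matching values, can be glued along a monotone partition `p`. -/
theorem exists_continuous_eqOn_Icc_partition (m : ℕ) {p y : ℕ → ℝ} (hp : Monotone p)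
    {f : ℕ → ℝ → ℝ} (hf : ∀ j < m, Continuous (f j))
    (hleft : ∀ j < m, ∀ x ≤ p j, f j x = y j)
    (hright : ∀ j < m, ∀ x, p (j + 1) ≤ x → f j x = y (j + 1)) :
    ∃ F : ℝ → ℝ, Continuous F ∧ ∀ j < m, EqOn F (f j) (Icc (p j) (p (j + 1))) := by
  refine ⟨fun x => y 0 + ∑ j ∈ Finset.range m, (f j x - y j), ?_, fun k hk x hx => ?_⟩
  · refine continuous_const.add (continuous_finsetSum _ fun j hj => ?_)
    exact (hf j (Finset.mem_range.1 hj)).sub continuous_const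
  · have hlow : ∑ j ∈ Finset.range k, (f j x - y j) = y k - y 0 := by
      rw [← Finset.sum_range_sub]
      refine Finset.sum_congr rfl fun j hj => ?_
      have hjk := Finset.mem_range.1 hj
      rw [hright j (hjk.trans hk) x ((hp hjk).trans hx.1)]
    have hhigh : ∑ j ∈ Finset.Ico (k + 1) m, (f j x - y j) = 0 := by
      refine Finset.sum_eq_zero fun j hj => ?_
      obtain ⟨hkj, hjm⟩ := Finset.mem_Ico.1 hj
      rw [hleft j hjm x (hx.2.trans (hp hkj)), sub_self]
    simp only
    rw [← Finset.sum_range_add_sum_Ico _ (show k + 1 ≤ m from hk), Finset.sum_range_succ, hlow,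
      hhigh]
    ring

theorem exists_mem_Icc_natCast_div {m : ℕ} (hm : 0 < m) {x : ℝ} (hx : x ∈ Icc (0 : ℝ) 1) :
    ∃ j < m, x ∈ Icc ((j : ℝ) / m) ((j + 1 : ℕ) / m) := by
  have hm' : (0 : ℝ) < m := Nat.cast_pos.2 hm
  rcases hx.2.eq_or_lt with rfl | hx1
  · refine ⟨m - 1, by omega, ?_, ?_⟩
    · rw [div_le_one hm']
      exact_mod_cast Nat.sub_le m 1
    · rw [Nat.sub_add_cancel hm, div_self hm'.ne']
  · refine ⟨⌊x * m⌋₊, ?_, ?_, ?_⟩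
    · rw [Nat.floor_lt (mul_nonneg hx.1 hm'.le)]
      nlinarith
    · rw [div_le_iff₀ hm']
      exact Nat.floor_le (mul_nonneg hx.1 hm'.le)
    · rw [le_div_iff₀ hm']
      push_cast
      exact (Nat.lt_floor_add_one _).le


/-- **Existence and uniqueness of a continuous local fractal interpolation function.**
Same set-up as the well-definedness statement: `n = 2m` even, intervals
`X (2j−1) = X (2j) = [(2j−2)/n, 2j/n]`, maps `l (2j−1) t = t/2 + (j−1)/n`,
`l (2j) t = t/2 + j/n`, values `y 0, …, y m`, continuous `q i, s i`, with the endpoint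
and join-up conditions and `max_i sup_{t ∈ X i} |s i t| < 1`.  Then there is a unique
continuous `ψ : [0,1] → ℝ` with `ψ (2j/n) = y j` for all `j` and
`ψ (l i t) = q i t + s i t * ψ t` for all `t ∈ X i` and all `i`. -/
theorem stmt8 (m : ℕ) (hm : 0 < m)
    (y : ℕ → ℝ) (q s : ℕ → ℝ → ℝ)
    (hqc : ∀ j, 1 ≤ j → j ≤ m →
      ContinuousOn (q (2 * j - 1))
        (Set.Icc ((2 * (j : ℝ) - 2) / (2 * m)) ((2 * (j : ℝ)) / (2 * m))) ∧
      ContinuousOn (q (2 * j))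
        (Set.Icc ((2 * (j : ℝ) - 2) / (2 * m)) ((2 * (j : ℝ)) / (2 * m))))
    (hsc : ∀ j, 1 ≤ j → j ≤ m →
      ContinuousOn (s (2 * j - 1))
        (Set.Icc ((2 * (j : ℝ) - 2) / (2 * m)) ((2 * (j : ℝ)) / (2 * m))) ∧
      ContinuousOn (s (2 * j))
        (Set.Icc ((2 * (j : ℝ) - 2) / (2 * m)) ((2 * (j : ℝ)) / (2 * m))))
    (hend1 : ∀ j, 1 ≤ j → j ≤ m →
      q (2 * j - 1) ((2 * (j : ℝ) - 2) / (2 * m)) +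
        (s (2 * j - 1) ((2 * (j : ℝ) - 2) / (2 * m)) - 1) * y (j - 1) = 0)
    (hend2 : ∀ j, 1 ≤ j → j ≤ m →
      q (2 * j) ((2 * (j : ℝ)) / (2 * m)) +
        (s (2 * j) ((2 * (j : ℝ)) / (2 * m)) - 1) * y j = 0)
    (hjoin : ∀ j, 1 ≤ j → j ≤ m →
      q (2 * j) ((2 * (j : ℝ) - 2) / (2 * m)) +
          s (2 * j) ((2 * (j : ℝ) - 2) / (2 * m)) * y (j - 1) =
        q (2 * j - 1) ((2 * (j : ℝ)) / (2 * m)) +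
          s (2 * j - 1) ((2 * (j : ℝ)) / (2 * m)) * y j)
    (hcontr : ∃ c : ℝ, c < 1 ∧ ∀ j, 1 ≤ j → j ≤ m →
      ∀ t ∈ Set.Icc ((2 * (j : ℝ) - 2) / (2 * m)) ((2 * (j : ℝ)) / (2 * m)),
        |s (2 * j - 1) t| ≤ c ∧ |s (2 * j) t| ≤ c) :
    ∃ ψ : ℝ → ℝ,
      (ContinuousOn ψ (Set.Icc (0 : ℝ) 1) ∧
        (∀ j ≤ m, ψ ((2 * (j : ℝ)) / (2 * m)) = y j) ∧
        ∀ j, 1 ≤ j → j ≤ m →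
          ∀ t ∈ Set.Icc ((2 * (j : ℝ) - 2) / (2 * m)) ((2 * (j : ℝ)) / (2 * m)),
            ψ (t / 2 + ((j : ℝ) - 1) / (2 * m)) =
              q (2 * j - 1) t + s (2 * j - 1) t * ψ t ∧
            ψ (t / 2 + (j : ℝ) / (2 * m)) = q (2 * j) t + s (2 * j) t * ψ t) ∧
      ∀ φ : ℝ → ℝ,
        (ContinuousOn φ (Set.Icc (0 : ℝ) 1) ∧
          (∀ j ≤ m, φ ((2 * (j : ℝ)) / (2 * m)) = y j) ∧
          ∀ j, 1 ≤ j → j ≤ m →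
            ∀ t ∈ Set.Icc ((2 * (j : ℝ) - 2) / (2 * m)) ((2 * (j : ℝ)) / (2 * m)),
              φ (t / 2 + ((j : ℝ) - 1) / (2 * m)) =
                q (2 * j - 1) t + s (2 * j - 1) t * φ t ∧
              φ (t / 2 + (j : ℝ) / (2 * m)) = q (2 * j) t + s (2 * j) t * φ t) →
        Set.EqOn φ ψ (Set.Icc (0 : ℝ) 1) := by
  obtain ⟨c, hc, hs⟩ := hcontr
  have hm' : (0 : ℝ) < m := Nat.cast_pos.2 hm
  let p : ℕ → ℝ := fun j => (j : ℝ) / m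
  have hp : Monotone p := fun i j hij =>
    div_le_div_of_nonneg_right (Nat.cast_le.2 hij) hm'.le
  have hlt : ∀ j, p j < p (j + 1) := fun j =>
    div_lt_div_of_pos_right (Nat.cast_lt.2 j.lt_succ_self) hm'
  have hpr : ∀ j : ℕ, 2 * (j : ℝ) / (2 * m) = p j := fun j =>
    mul_div_mul_left _ _ two_ne_zero
  have hpl : ∀ j : ℕ, (2 * ((j + 1 : ℕ) : ℝ) - 2) / (2 * m) = p j := fun j => by
    rw [← hpr]
    push_cast
    ring
  have hl₁ : ∀ (j : ℕ) (t : ℝ), t / 2 + (((j + 1 : ℕ) : ℝ) - 1) / (2 * m) = (t + p j) / 2 :=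
    fun j t => by
      simp only [p]
      push_cast
      field_simp
      ring
  have hl₂ : ∀ (j : ℕ) (t : ℝ), t / 2 + ((j + 1 : ℕ) : ℝ) / (2 * m) = (t + p (j + 1)) / 2 :=
    fun j t => by
      simp only [p]
      field_simp
  have hsub : ∀ j < m, Icc (p j) (p (j + 1)) ⊆ Icc 0 1 := fun j hj =>
    Icc_subset_Icc (by positivity) ((div_le_one hm').2 (Nat.cast_le.2 hj))
  -- Shift the index to start at zero, writing the grid points as `p j`.
  have shift : ∀ {P : ℕ → Prop}, (∀ j, 1 ≤ j → j ≤ m → P j) → ∀ j < m, P (j + 1) :=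
    fun h j hj => h (j + 1) (Nat.le_add_left 1 j) hj
  replace hqc := shift hqc
  replace hsc := shift hsc
  replace hend1 := shift hend1
  replace hend2 := shift hend2
  replace hjoin := shift hjoin
  replace hs := shift hs
  simp only [hpl, hpr, Nat.add_sub_cancel] at hqc hsc hend1 hend2 hjoin hs
  have hex : ∀ j, ∃ f : ℝ → ℝ, j < m →
      Continuous f ∧ (∀ x ≤ p j, f x = y j) ∧ (∀ x, p (j + 1) ≤ x → f x = y (j + 1)) ∧
      ∀ t ∈ Icc (p j) (p (j + 1)),
        f ((t + p j) / 2) = q (2 * (j + 1) - 1) t + s (2 * (j + 1) - 1) t * f t ∧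
        f ((t + p (j + 1)) / 2) = q (2 * (j + 1)) t + s (2 * (j + 1)) t * f t := by
    intro j
    by_cases hj : j < m
    · obtain ⟨f, hf⟩ := exists_continuous_fractal_interpolation (hlt j) hc (hqc j hj).1
        (hqc j hj).2 (hsc j hj).1 (hsc j hj).2 (u := y j) (v := y (j + 1))
        (by linear_combination hend1 j hj) (by linear_combination hend2 j hj) (hjoin j hj)
        (hs j hj)
      exact ⟨f, fun _ => hf⟩
    · exact ⟨0, fun h => absurd h hj⟩
  choose f hf using hex
  obtain ⟨ψ, hψ, hψf⟩ := exists_continuous_eqOn_Icc_partition m hp (fun j hj => (hf j hj).1)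
    (fun j hj => (hf j hj).2.1) (fun j hj => (hf j hj).2.2.1)
  have hψeq : ∀ j < m, ∀ t ∈ Icc (p j) (p (j + 1)),
      ψ ((t + p j) / 2) = q (2 * (j + 1) - 1) t + s (2 * (j + 1) - 1) t * ψ t ∧
      ψ ((t + p (j + 1)) / 2) = q (2 * (j + 1)) t + s (2 * (j + 1)) t * ψ t := by
    intro j hj t ht
    rw [hψf j hj ht, hψf j hj (half_add_left_mem_Icc ht), hψf j hj (half_add_right_mem_Icc ht)]
    exact (hf j hj).2.2.2 t ht
  refine ⟨ψ, ⟨hψ.continuousOn, fun j hj => ?_, fun j hj1 hjm => ?_⟩, ?_⟩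
  · rw [hpr]
    rcases hj.lt_or_eq with hj | rfl
    · rw [hψf j hj (left_mem_Icc.2 (hlt j).le)]
      exact (hf j hj).2.1 _ le_rfl
    · obtain ⟨k, rfl⟩ := Nat.exists_eq_succ_of_ne_zero hm.ne'
      rw [hψf k k.lt_succ_self (right_mem_Icc.2 (hlt k).le)]
      exact (hf k k.lt_succ_self).2.2.1 _ le_rfl
  · obtain ⟨k, rfl⟩ := Nat.exists_eq_succ_of_ne_zero (Nat.one_le_iff_ne_zero.1 hj1)
    simp only [Nat.succ_eq_add_one, hpl, hpr, hl₁, hl₂]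
    exact hψeq k hjm
  · rintro φ ⟨hφ, -, hφeq⟩ x hx
    replace hφeq := shift hφeq
    simp only [hpl, hpr, hl₁, hl₂] at hφeq
    obtain ⟨j, hj, hxj⟩ := exists_mem_Icc_natCast_div hm hx
    exact eqOn_Icc_of_fractal_functional_equation (hlt j).le hc (hs j hj) (hφ.mono (hsub j hj))
      hψ.continuousOn (hφeq j hj) (hψeq j hj) hxj
end

section
/- Let (V, d) be a complete metric space, let I ⊆ V be nonempty, closed, and bounded, and let (T_k)_{k∈ℕ} be maps T_k : V → V with T_k(I) ⊆ I for all k. Suppose there are constants L_k ≥ 0 with d(T_k(x), T_k(y)) ≤ L_k·d(x, y) for all x, y ∈ I and all k, and that ∑_{k=1}^∞ ∏_{j=1}^k L_j < ∞. Then there exists ψ ∈ I such that for every f₀ ∈ I the backward trajectories Ψ_k(f₀) := (T_1 ∘ T_2 ∘ ⋯ ∘ T_k)(f₀) converge to ψ as k → ∞; in particular the limit is independent of the initial point f₀ ∈ I. -/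
/-- The backward trajectory operator of a sequence of maps `T 0, T 1, T 2, …`:
`backTraj T k = T 0 ∘ T 1 ∘ ⋯ ∘ T (k-1)` (so with 1-based indexing this is
`T_1 ∘ T_2 ∘ ⋯ ∘ T_k`). -/
def backTraj {V : Type*} (T : ℕ → V → V) : ℕ → V → V
  | 0 => id
  | k + 1 => fun v => backTraj T k (T k v)

theorem backTraj_mapsTo {V : Type*} {I : Set V} {T : ℕ → V → V}
    (hTI : ∀ k, Set.MapsTo (T k) I I) (k : ℕ) : Set.MapsTo (backTraj T k) I I := by
  induction k with
  | zero => exact Set.mapsTo_id I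
  | succ k ih => exact ih.comp (hTI k)

theorem dist_backTraj_le {V : Type*} [PseudoMetricSpace V] {I : Set V} {T : ℕ → V → V}
    (hTI : ∀ k, Set.MapsTo (T k) I I) {L : ℕ → ℝ} (hL0 : ∀ k, 0 ≤ L k)
    (hLip : ∀ k, ∀ x ∈ I, ∀ y ∈ I, dist (T k x) (T k y) ≤ L k * dist x y) (k : ℕ)
    {x y : V} (hx : x ∈ I) (hy : y ∈ I) :
    dist (backTraj T k x) (backTraj T k y) ≤ (∏ j ∈ Finset.range k, L j) * dist x y := by
  induction k generalizing x y with
  | zero => simp [backTraj]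
  | succ k ih =>
    calc dist (backTraj T k (T k x)) (backTraj T k (T k y))
        ≤ (∏ j ∈ Finset.range k, L j) * dist (T k x) (T k y) := ih (hTI k hx) (hTI k hy)
      _ ≤ (∏ j ∈ Finset.range k, L j) * (L k * dist x y) :=
        mul_le_mul_of_nonneg_left (hLip k x hx y hy) (Finset.prod_nonneg fun j _ => hL0 j)
      _ = (∏ j ∈ Finset.range (k + 1), L j) * dist x y := by
        rw [Finset.prod_range_succ, mul_assoc]

/-- **Convergence of backward trajectories.**
Let `(V, d)` be a complete metric space, `I ⊆ V` nonempty, closed and bounded, and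
`T k : V → V` maps with `T k (I) ⊆ I`.  If there are constants `L k ≥ 0` with
`d(T k x, T k y) ≤ L k · d(x, y)` on `I` and `∑_{k≥1} ∏_{j=1}^k L j < ∞`, then there is
`ψ ∈ I` such that for every `f₀ ∈ I` the backward trajectories
`Ψ k f₀ = T_1 ∘ ⋯ ∘ T_k (f₀)` converge to `ψ`; in particular the limit does not depend
on `f₀`. -/
theorem stmt11 {V : Type*} [MetricSpace V] [CompleteSpace V]
    (I : Set V) (hne : I.Nonempty) (hcl : IsClosed I) (hbd : Bornology.IsBounded I)
    (T : ℕ → V → V) (hTI : ∀ k, Set.MapsTo (T k) I I)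
    (L : ℕ → ℝ) (hL0 : ∀ k, 0 ≤ L k)
    (hLip : ∀ k, ∀ x ∈ I, ∀ y ∈ I, dist (T k x) (T k y) ≤ L k * dist x y)
    (hsum : Summable fun k => ∏ j ∈ Finset.range (k + 1), L j) :
    ∃ ψ ∈ I, ∀ f₀ ∈ I,
      Filter.Tendsto (fun k => backTraj T k f₀) Filter.atTop (nhds ψ) := by
  obtain ⟨a, ha⟩ := hne
  replace hsum : Summable fun k => ∏ j ∈ Finset.range k, L j := (summable_nat_add_iff 1).1 hsum
  have hdist (k : ℕ) {x y : V} (hx : x ∈ I) (hy : y ∈ I) :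
      dist (backTraj T k x) (backTraj T k y) ≤
        (∏ j ∈ Finset.range k, L j) * Metric.diam I :=
    (dist_backTraj_le hTI hL0 hLip k hx hy).trans <|
      mul_le_mul_of_nonneg_left (Metric.dist_le_diam_of_mem hbd hx hy)
        (Finset.prod_nonneg fun j _ => hL0 j)
  have hsum' := hsum.mul_right (Metric.diam I)
  have hcauchy : CauchySeq fun k => backTraj T k a :=
    cauchySeq_of_dist_le_of_summable _ (fun k => hdist k ha (hTI k ha)) hsum'
  obtain ⟨ψ, hψ⟩ := cauchySeq_tendsto_of_complete hcauchy
  refine ⟨ψ, hcl.mem_of_tendsto hψ (.of_forall fun k => backTraj_mapsTo hTI k ha),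
    fun f₀ hf => ?_⟩
  exact hψ.congr_dist <|
    squeeze_zero (fun _ => dist_nonneg) (fun k => hdist k ha hf) hsum'.tendsto_atTop_zero
end

section
/- In the non-stationary setting, suppose sup_{k∈ℕ} max_{1≤i≤n_k} sup_{x∈X} ‖q_{i,k}(x)‖ ≤ M for some M > 0, and let I be the closed ball of radius M/(1−s) centered at the zero function in the space of bounded functions X → F with the sup-norm. Then there exists ψ ∈ I such that for every f₀ ∈ I the backward trajectories Ψ_k(f₀) := (T_1 ∘ T_2 ∘ ⋯ ∘ T_k)(f₀) converge uniformly on X to ψ as k → ∞; in particular the limit is independent of f₀. -/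
/-- A composition of `k` maps that contract pointwise bounds by `c` contracts them by `c ^ k`. -/
theorem norm_backTraj_sub_le {α F : Type*} [SeminormedAddCommGroup F]
    {T : ℕ → (α → F) → (α → F)} {c : ℝ}
    (hT : ∀ k f g d, (∀ x, ‖f x - g x‖ ≤ d) → ∀ x, ‖T k f x - T k g x‖ ≤ c * d)
    (k : ℕ) {f g : α → F} {d : ℝ} (h : ∀ x, ‖f x - g x‖ ≤ d) (x : α) :
    ‖backTraj T k f x - backTraj T k g x‖ ≤ c ^ k * d := by
  induction k generalizing f g d with
  | zero => simpa [backTraj] using h x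
  | succ k ih =>
    rw [pow_succ, mul_assoc]
    exact ih (hT k f g d h)

/-- Backward trajectories preserve every property preserved by each of the maps. -/
theorem backTraj_invariant {V : Type*} {T : ℕ → V → V} {p : V → Prop}
    (hT : ∀ k v, p v → p (T k v)) (k : ℕ) {v : V} (hv : p v) : p (backTraj T k v) := by
  induction k generalizing v with
  | zero => exact hv
  | succ k ih => exact ih (hT k v hv)

/-- Backward trajectories of uniformly contracting maps preserving a ball of bounded functions
converge uniformly to a common limit in that ball. -/
theorem exists_tendstoUniformly_backTraj {α F : Type*} [NormedAddCommGroup F] [CompleteSpace F]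
    {T : ℕ → (α → F) → (α → F)} {c R : ℝ} (hc0 : 0 ≤ c) (hc : c < 1) (hR : 0 ≤ R)
    (hball : ∀ k f, (∀ x, ‖f x‖ ≤ R) → ∀ x, ‖T k f x‖ ≤ R)
    (hT : ∀ k f g d, (∀ x, ‖f x - g x‖ ≤ d) → ∀ x, ‖T k f x - T k g x‖ ≤ c * d) :
    ∃ ψ : α → F, (∀ x, ‖ψ x‖ ≤ R) ∧ ∀ f₀ : α → F, (∀ x, ‖f₀ x‖ ≤ R) →
      TendstoUniformly (fun k => backTraj T k f₀) ψ Filter.atTop := by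
  have hzero : ∀ x, ‖(0 : α → F) x‖ ≤ R := fun x => by simpa using hR
  have hstep : ∀ x k, dist (backTraj T k 0 x) (backTraj T (k + 1) 0 x) ≤ R * c ^ k := by
    intro x k
    rw [dist_eq_norm, mul_comm]
    exact norm_backTraj_sub_le hT k (fun y => by simpa using hball k 0 hzero y) x
  choose ψ hψ using fun x =>
    cauchySeq_tendsto_of_complete (cauchySeq_of_le_geometric c R hc (hstep x))
  refine ⟨ψ, fun x => le_of_tendsto (hψ x).norm (Filter.Eventually.of_forall fun k =>
    backTraj_invariant (p := fun f : α → F => ∀ x, ‖f x‖ ≤ R) hball k hzero x), fun f₀ hf₀ => ?_⟩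
  have hbound : ∀ k x, dist (ψ x) (backTraj T k f₀ x) ≤ R * c ^ k / (1 - c) + c ^ k * R := by
    intro k x
    refine (dist_triangle_left _ _ (backTraj T k 0 x)).trans (add_le_add
      (dist_le_of_le_geometric_of_tendsto c R hc (hstep x) (hψ x) k) ?_)
    rw [dist_eq_norm]
    exact norm_backTraj_sub_le hT k (fun y => by simpa using hf₀ y) x
  have hlim : Filter.Tendsto (fun k : ℕ => R * c ^ k / (1 - c) + c ^ k * R)
      Filter.atTop (nhds 0) := by
    have hpow := tendsto_pow_atTop_nhds_zero_of_lt_one hc0 hc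
    simpa using ((hpow.const_mul R).div_const (1 - c)).add (hpow.mul_const R)
  rw [Metric.tendstoUniformly_iff]
  intro ε hε
  filter_upwards [hlim.eventually_lt_const hε] with k hk x
  exact (hbound k x).trans_lt hk

/-- **Convergence of backward trajectories of non-stationary RB operators.**
Non-stationary setting: `X` a nonempty bounded subset of a real normed space, `F` a real
Banach space; for each `k`, injections `l k i : X → X` with pairwise disjoint images
covering `X`, bounded `s k i : X → ℝ` with `|s k i x| ≤ c < 1` and `q k i : X → F` with
`‖q k i x‖ ≤ M` (`M > 0`), and RB operators `T k f (l k i x) = q k i x + s k i x • f x`.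
Then there is `ψ` in the sup-norm ball `I` of radius `M / (1 − c)` about `0` such that
for every `f₀ ∈ I` the backward trajectories `T_1 ∘ ⋯ ∘ T_k (f₀)` converge uniformly on
`X` to `ψ`; in particular the limit is independent of `f₀`. -/
theorem stmt12 {E F : Type*} [NormedAddCommGroup E] [NormedSpace ℝ E]
    [NormedAddCommGroup F] [NormedSpace ℝ F] [CompleteSpace F]
    (X : Set E) (hXne : X.Nonempty) (hXbd : Bornology.IsBounded X)
    (n : ℕ → ℕ) (hn : ∀ k, 0 < n k)
    (l : (k : ℕ) → Fin (n k) → X → X)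
    (hinj : ∀ k i, Function.Injective (l k i))
    (hdisj : ∀ k i j, i ≠ j → Disjoint (Set.range (l k i)) (Set.range (l k j)))
    (hcover : ∀ k (z : X), ∃ i, z ∈ Set.range (l k i))
    (s : (k : ℕ) → Fin (n k) → X → ℝ)
    (q : (k : ℕ) → Fin (n k) → X → F)
    (c : ℝ) (hc : c < 1) (hsc : ∀ k i x, |s k i x| ≤ c)
    (M : ℝ) (hM : 0 < M) (hqM : ∀ k i x, ‖q k i x‖ ≤ M)
    (T : ℕ → (X → F) → (X → F))
    (hT : ∀ k f i x, T k f (l k i x) = q k i x + s k i x • f x) :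
    ∃ ψ : X → F, (∀ x, ‖ψ x‖ ≤ M / (1 - c)) ∧
      ∀ f₀ : X → F, (∀ x, ‖f₀ x‖ ≤ M / (1 - c)) →
        TendstoUniformly (fun k => backTraj T k f₀) ψ Filter.atTop := by
  obtain ⟨x₀, hx₀⟩ := hXne
  have hc0 : 0 ≤ c := (abs_nonneg _).trans (hsc 0 ⟨0, hn 0⟩ ⟨x₀, hx₀⟩)
  have h1c : 0 < 1 - c := sub_pos.2 hc
  refine exists_tendstoUniformly_backTraj hc0 hc (div_pos hM h1c).le ?_ ?_
  · intro k f hf z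
    obtain ⟨i, x, rfl⟩ := hcover k z
    rw [hT]
    calc ‖q k i x + s k i x • f x‖ ≤ ‖q k i x‖ + |s k i x| * ‖f x‖ := by
          simpa [norm_smul] using norm_add_le (q k i x) (s k i x • f x)
      _ ≤ M + c * (M / (1 - c)) :=
          add_le_add (hqM k i x) (mul_le_mul (hsc k i x) (hf x) (norm_nonneg _) hc0)
      _ = M / (1 - c) := by field_simp; ring
  · intro k f g d h z
    obtain ⟨i, x, rfl⟩ := hcover k z
    rw [hT, hT, add_sub_add_left_eq_sub, ← smul_sub, norm_smul, Real.norm_eq_abs]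
    exact mul_le_mul (hsc k i x) (h x) (norm_nonneg _) hc0
end

section
/- Let V be a two-sided quaternionic vector space and let V_ℝ := {v ∈ V : q·v = v·q for all q ∈ ℍ} be its real part, which is an ℝ-subspace of V. Then the ℝ-linear map V_ℝ ⊗_ℝ ℍ → V induced by v ⊗ q ↦ v·q is bijective; that is, V is isomorphic to V_ℝ ⊗_ℝ ℍ. -/
open scoped Quaternion
open MulOpposite TensorProduct

/-- The real part `V_ℝ = {v ∈ V : q • v = v • q for all q ∈ ℍ}` of a two-sided
quaternionic vector space `V`, as an `ℝ`-subspace of `V`. -/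
def quatRealPart (V : Type*) [AddCommGroup V] [Module ℝ V]
    [Module ℍ[ℝ] V] [Module ℍ[ℝ]ᵐᵒᵖ V]
    [IsScalarTower ℝ ℍ[ℝ] V] [IsScalarTower ℝ ℍ[ℝ]ᵐᵒᵖ V] :
    Submodule ℝ V where
  carrier := {v : V | ∀ q : ℍ[ℝ], q • v = op q • v}
  add_mem' := by
    intro a b ha hb q
    rw [smul_add, smul_add, ha q, hb q]
  zero_mem' := by
    intro q
    rw [smul_zero, smul_zero]
  smul_mem' := by
    intro c v hv q
    rw [← smul_comm c q v, ← smul_comm c (op q) v, hv q]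

namespace QuatBimodule

/-- The quaternion unit `i`. -/
def unitI : ℍ[ℝ] := ⟨0, 1, 0, 0⟩

/-- The quaternion unit `j`. -/
def unitJ : ℍ[ℝ] := ⟨0, 0, 1, 0⟩

/-- The quaternion unit `k`. -/
def unitK : ℍ[ℝ] := ⟨0, 0, 0, 1⟩

@[simp] theorem re_unitI : unitI.re = 0 := rfl
@[simp] theorem imI_unitI : unitI.imI = 1 := rfl
@[simp] theorem imJ_unitI : unitI.imJ = 0 := rfl
@[simp] theorem imK_unitI : unitI.imK = 0 := rfl

@[simp] theorem re_unitJ : unitJ.re = 0 := rfl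
@[simp] theorem imI_unitJ : unitJ.imI = 0 := rfl
@[simp] theorem imJ_unitJ : unitJ.imJ = 1 := rfl
@[simp] theorem imK_unitJ : unitJ.imK = 0 := rfl

@[simp] theorem re_unitK : unitK.re = 0 := rfl
@[simp] theorem imI_unitK : unitK.imI = 0 := rfl
@[simp] theorem imJ_unitK : unitK.imJ = 0 := rfl
@[simp] theorem imK_unitK : unitK.imK = 1 := rfl

theorem unit_mul_unit :
    unitI * unitI = -1 ∧ unitJ * unitJ = -1 ∧ unitK * unitK = -1 ∧
    unitI * unitJ = unitK ∧ unitJ * unitI = -unitK ∧ unitJ * unitK = unitI ∧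
    unitK * unitJ = -unitI ∧ unitK * unitI = unitJ ∧ unitI * unitK = -unitJ := by
  refine ⟨?_, ?_, ?_, ?_, ?_, ?_, ?_, ?_, ?_⟩ <;>
    ext <;> simp

theorem eq_sum_units (q : ℍ[ℝ]) :
    q = q.re • 1 + q.imI • unitI + q.imJ • unitJ + q.imK • unitK := by
  ext <;> simp

section LeftRight

variable {V : Type*} [AddCommGroup V]

section Left

variable [Module ℍ[ℝ] V]

theorem smul_eq_sum [Module ℝ V] [IsScalarTower ℝ ℍ[ℝ] V] (q : ℍ[ℝ]) (v : V) :
    q • v = q.re • v + q.imI • unitI • v + q.imJ • unitJ • v + q.imK • unitK • v := by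
  conv_lhs => rw [eq_sum_units q]
  simp only [add_smul, smul_assoc, one_smul]

theorem unit_smul_unit_smul (v : V) :
    unitI • unitI • v = -v ∧ unitJ • unitJ • v = -v ∧ unitK • unitK • v = -v ∧
    unitI • unitJ • v = unitK • v ∧ unitJ • unitI • v = -(unitK • v) ∧
    unitJ • unitK • v = unitI • v ∧ unitK • unitJ • v = -(unitI • v) ∧
    unitK • unitI • v = unitJ • v ∧ unitI • unitK • v = -(unitJ • v) := by
  obtain ⟨h1, h2, h3, h4, h5, h6, h7, h8, h9⟩ := unit_mul_unit
  simp only [smul_smul, h1, h2, h3, h4, h5, h6, h7, h8, h9, neg_smul, one_smul, and_self]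

end Left

section Right

variable [Module ℍ[ℝ]ᵐᵒᵖ V]

theorem op_smul_eq_sum [Module ℝ V] [IsScalarTower ℝ ℍ[ℝ]ᵐᵒᵖ V] (q : ℍ[ℝ]) (v : V) :
    op q • v = q.re • v + q.imI • op unitI • v + q.imJ • op unitJ • v +
      q.imK • op unitK • v := by
  conv_lhs => rw [eq_sum_units q]
  simp only [op_add, op_smul, op_one, add_smul, smul_assoc, one_smul]

theorem op_unit_smul_op_unit_smul (v : V) :
    op unitI • op unitI • v = -v ∧ op unitJ • op unitJ • v = -v ∧
    op unitK • op unitK • v = -v ∧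
    op unitJ • op unitI • v = op unitK • v ∧ op unitI • op unitJ • v = -(op unitK • v) ∧
    op unitK • op unitJ • v = op unitI • v ∧ op unitJ • op unitK • v = -(op unitI • v) ∧
    op unitI • op unitK • v = op unitJ • v ∧ op unitK • op unitI • v = -(op unitJ • v) := by
  obtain ⟨h1, h2, h3, h4, h5, h6, h7, h8, h9⟩ := unit_mul_unit
  simp only [smul_smul, ← op_mul, h1, h2, h3, h4, h5, h6, h7, h8, h9, op_neg, op_one, neg_smul,
    one_smul, and_self]

end Right

end LeftRight

variable {V : Type*} [AddCommGroup V] [Module ℝ V]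
  [Module ℍ[ℝ] V] [Module ℍ[ℝ]ᵐᵒᵖ V]
  [IsScalarTower ℝ ℍ[ℝ] V] [IsScalarTower ℝ ℍ[ℝ]ᵐᵒᵖ V]

theorem mem_quatRealPart_of_units {v : V} (hI : unitI • v = op unitI • v)
    (hJ : unitJ • v = op unitJ • v) (hK : unitK • v = op unitK • v) :
    v ∈ quatRealPart V := fun q => by
  rw [smul_eq_sum, op_smul_eq_sum, hI, hJ, hK]

/-- The map `v ⊗ q ↦ v q`. -/
noncomputable def mulMap : quatRealPart V ⊗[ℝ] ℍ[ℝ] →ₗ[ℝ] V :=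
  TensorProduct.lift (LinearMap.mk₂ ℝ (fun (v : quatRealPart V) (q : ℍ[ℝ]) => op q • (v : V))
    (fun _ _ _ => by simp only [Submodule.coe_add, smul_add])
    (fun r _ _ => by rw [Submodule.coe_smul, smul_comm])
    (fun _ _ _ => by rw [op_add, add_smul])
    (fun r _ _ => by rw [op_smul, smul_assoc]))

theorem mulMap_tmul (v : quatRealPart V) (q : ℍ[ℝ]) : mulMap (v ⊗ₜ[ℝ] q) = op q • (v : V) := rfl

variable [SMulCommClass ℍ[ℝ] ℍ[ℝ]ᵐᵒᵖ V]

/-- The average `(v - i v i - j v j - k v k) / 4`, a projection of `V` onto its real part. -/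
noncomputable def realProj : V →ₗ[ℝ] quatRealPart V where
  toFun v := ⟨(1 / 4 : ℝ) • (v - unitI • op unitI • v - unitJ • op unitJ • v -
      unitK • op unitK • v), by
    obtain ⟨l1, l2, l3, l4, l5, l6, l7, l8, l9⟩ := forall_and.1 (unit_smul_unit_smul (V := V))
      |>.imp id fun h => by simpa only [forall_and] using h
    obtain ⟨r1, r2, r3, r4, r5, r6, r7, r8, r9⟩ :=
      forall_and.1 (op_unit_smul_op_unit_smul (V := V))
      |>.imp id fun h => by simpa only [forall_and] using h
    have c (a b : ℍ[ℝ]) (v : V) : op a • b • v = b • op a • v :=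
      (smul_comm b (op a) v).symm
    apply mem_quatRealPart_of_units <;>
    · rw [smul_comm _ (1 / 4 : ℝ), smul_comm _ (1 / 4 : ℝ)]
      simp only [smul_sub, smul_neg, c, l1, l2, l3, l4, l5, l6, l7, l8, l9,
        r1, r2, r3, r4, r5, r6, r7, r8, r9]
      abel⟩
  map_add' x y := by
    ext
    simp only [Submodule.coe_add, smul_add, smul_sub]
    abel
  map_smul' r x := by
    ext
    simp only [smul_comm _ r, RingHom.id_apply, Submodule.coe_smul, smul_sub]

theorem coe_realProj (v : V) : (realProj v : V) =
    (1 / 4 : ℝ) • (v - unitI • op unitI • v - unitJ • op unitJ • v - unitK • op unitK • v) := rfl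

theorem realProj_op_smul (w : quatRealPart V) (q : ℍ[ℝ]) :
    realProj (op q • (w : V)) = q.re • w := by
  have c (a b : ℍ[ℝ]) (v : V) : b • op a • v = op a • b • v := smul_comm _ _ _
  obtain ⟨r1, r2, r3, r4, r5, r6, r7, r8, r9⟩ :=
    forall_and.1 (op_unit_smul_op_unit_smul (V := V))
      |>.imp id fun h => by simpa only [forall_and] using h
  ext
  rw [coe_realProj, Submodule.coe_smul]
  simp only [c, w.2 _]
  simp only [op_smul_eq_sum q, smul_add, smul_comm _ (_ : ℝ) (_ : V), smul_neg,
    r1, r2, r3, r4, r5, r6, r7, r8, r9]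
  generalize op unitI • (w : V) = x, op unitJ • (w : V) = y, op unitK • (w : V) = z
  module

/-- The components of `v` along `1, i, j, k`. -/
noncomputable def components (v : V) : quatRealPart V ⊗[ℝ] ℍ[ℝ] :=
  realProj v ⊗ₜ 1 - realProj (op unitI • v) ⊗ₜ unitI - realProj (op unitJ • v) ⊗ₜ unitJ -
    realProj (op unitK • v) ⊗ₜ unitK

theorem mulMap_components (v : V) : mulMap (components v) = v := by
  have c (a b : ℍ[ℝ]) (v : V) : op a • b • v = b • op a • v :=
      (smul_comm b (op a) v).symm
  obtain ⟨r1, r2, r3, r4, r5, r6, r7, r8, r9⟩ :=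
    forall_and.1 (op_unit_smul_op_unit_smul (V := V))
      |>.imp id fun h => by simpa only [forall_and] using h
  simp only [components, map_sub, mulMap_tmul, coe_realProj, op_one, one_smul,
    smul_comm _ (1 / 4 : ℝ) (_ : V)]
  simp only [smul_sub, smul_neg, c, r1, r2, r3, r4, r5, r6, r7, r8, r9]
  generalize unitI • op unitI • v = ii, unitI • op unitJ • v = ij, unitI • op unitK • v = ik
  generalize unitJ • op unitI • v = ji, unitJ • op unitJ • v = jj, unitJ • op unitK • v = jk
  generalize unitK • op unitI • v = ki, unitK • op unitJ • v = kj, unitK • op unitK • v = kk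
  module

theorem components_add (x y : V) : components (x + y) = components x + components y := by
  simp only [components, smul_add, map_add, add_tmul]
  abel

theorem components_mulMap (x : quatRealPart V ⊗[ℝ] ℍ[ℝ]) : components (mulMap x) = x := by
  induction x with
  | zero => simp [components]
  | add x y hx hy => rw [map_add, components_add, hx, hy]
  | tmul w q =>
    rw [mulMap_tmul]
    simp only [components, smul_smul, ← op_mul, realProj_op_smul, smul_tmul]
    simp only [← tmul_sub]
    congr 1
    ext <;> simp

end QuatBimodule

/-- **A two-sided quaternionic vector space is `V_ℝ ⊗_ℝ ℍ`.**
Let `V` be a two-sided quaternionic vector space (a real vector space with compatible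
left and right `ℍ`-module structures whose restrictions to `ℝ` agree with the real
scalar multiplication) and let `V_ℝ` be its real part.  Then the `ℝ`-linear map
`V_ℝ ⊗_ℝ ℍ → V` induced by `v ⊗ q ↦ v • q` exists and is bijective; that is,
`V ≅ V_ℝ ⊗_ℝ ℍ`. -/
theorem stmt16 (V : Type*) [AddCommGroup V] [Module ℝ V]
    [Module ℍ[ℝ] V] [Module ℍ[ℝ]ᵐᵒᵖ V]
    [IsScalarTower ℝ ℍ[ℝ] V] [IsScalarTower ℝ ℍ[ℝ]ᵐᵒᵖ V]
    [SMulCommClass ℍ[ℝ] ℍ[ℝ]ᵐᵒᵖ V] :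
    ∃ L : (quatRealPart V ⊗[ℝ] ℍ[ℝ]) →ₗ[ℝ] V,
      (∀ (v : quatRealPart V) (q : ℍ[ℝ]), L (v ⊗ₜ[ℝ] q) = op q • (v : V)) ∧
      Function.Bijective L := by
  exact ⟨QuatBimodule.mulMap, QuatBimodule.mulMap_tmul,
    Function.LeftInverse.injective QuatBimodule.components_mulMap,
    Function.RightInverse.surjective QuatBimodule.mulMap_components⟩
end

section
/- In the quaternionic setting, if max_{1≤i≤n} sup_{x∈X} |s_i(x)| < 1, then there exists a unique bounded function ψ : X → ℍ satisfying ψ(l_i(x)) = q_i(x) + s_i(x)·ψ(x) for all x ∈ X and all i = 1,…,n, where s_i(x)·ψ(x) denotes quaternion multiplication on the left. -/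
open scoped Quaternion

open BoundedContinuousFunction in
/-- An affine functional equation `ψ = q + s * (ψ ∘ σ)` with bounded `q` and with `s` uniformly
bounded by a constant less than one has a unique bounded solution. -/
theorem existsUnique_bounded_eq_add_mul_comp {α R : Type*} [NormedRing R] [CompleteSpace R]
    (σ : α → α) (q s : α → R) {M c : ℝ} (hq : ∀ x, ‖q x‖ ≤ M) (hc : c < 1)
    (hs : ∀ x, ‖s x‖ ≤ c) :
    ∃! ψ : α → R, (∃ B : ℝ, ∀ x, ‖ψ x‖ ≤ B) ∧ ∀ x, ψ x = q x + s x * ψ (σ x) := by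
  let : TopologicalSpace α := ⊥
  have : DiscreteTopology α := ⟨rfl⟩
  have bound (f : α →ᵇ R) (x : α) : ‖q x + s x * f (σ x)‖ ≤ M + c * ‖f‖ :=
    (norm_add_le _ _).trans <| add_le_add (hq x) <| (norm_mul_le _ _).trans <|
      mul_le_mul (hs x) (f.norm_coe_le_norm _) (norm_nonneg _) ((norm_nonneg _).trans (hs x))
  let T (f : α →ᵇ R) : α →ᵇ R := ofNormedAddCommGroupDiscrete _ _ (bound f)
  have hT : ContractingWith c.toNNReal T := by
    refine ⟨by simpa using hc, LipschitzWith.of_dist_le_mul fun f g ↦ ?_⟩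
    refine (dist_le (by positivity)).2 fun x ↦ ?_
    change dist (q x + s x * f (σ x)) (q x + s x * g (σ x)) ≤ _
    rw [dist_add_left, dist_eq_norm, ← mul_sub]
    refine (norm_mul_le _ _).trans ?_
    rw [← dist_eq_norm]
    gcongr
    · exact (hs x).trans (Real.le_coe_toNNReal c)
    · exact dist_coe_le_dist _
  let ψ : α →ᵇ R := ContractingWith.fixedPoint T hT
  have hfix : T ψ = ψ := hT.fixedPoint_isFixedPt
  refine ⟨ψ, ⟨⟨_, norm_coe_le_norm _⟩, fun x ↦ ?_⟩, ?_⟩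
  · exact (DFunLike.congr_fun hfix x).symm
  · rintro φ ⟨⟨B, hB⟩, hφ⟩
    let f : α →ᵇ R := ofNormedAddCommGroupDiscrete φ B hB
    have hf : T f = f := by
      ext x
      exact (hφ x).symm
    exact congrArg DFunLike.coe (hT.fixedPoint_unique hf)

/-- **Quaternionic fractal interpolation: existence and uniqueness.**
Let `X` be a nonempty compact subset of the quaternions `ℍ`, and `l 1, …, l n : X → X`
injective maps with pairwise disjoint images covering `X`.  Let `qf i, sf i : X → ℍ` be
bounded functions.  If `max_i sup_x |sf i x| < 1` (i.e. there is a common bound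
`c < 1`), then there is a unique bounded `ψ : X → ℍ` with
`ψ (l i x) = qf i x + sf i x * ψ x` (quaternionic multiplication on the left) for all
`x ∈ X` and all `i`. -/
theorem stmt17 (X : Set ℍ[ℝ]) (hXne : X.Nonempty) (hXcp : IsCompact X)
    (n : ℕ) (hn : 0 < n)
    (l : Fin n → X → X) (hinj : ∀ i, Function.Injective (l i))
    (hdisj : ∀ i j, i ≠ j → Disjoint (Set.range (l i)) (Set.range (l j)))
    (hcover : ∀ y : X, ∃ i, y ∈ Set.range (l i))
    (qf sf : Fin n → X → ℍ[ℝ])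
    (hqbd : ∀ i, ∃ M : ℝ, ∀ x, ‖qf i x‖ ≤ M)
    (hs : ∃ c : ℝ, c < 1 ∧ ∀ i x, ‖sf i x‖ ≤ c) :
    ∃! ψ : X → ℍ[ℝ], (∃ M : ℝ, ∀ x, ‖ψ x‖ ≤ M) ∧
      ∀ i x, ψ (l i x) = qf i x + sf i x * ψ x := by
  choose M hM using hqbd
  obtain ⟨c, hc, hs⟩ := hs
  choose a σ hσ using hcover
  have addr (i x) : a (l i x) = i ∧ σ (l i x) = x := by
    have ha : a (l i x) = i := by
      by_contra hne
      exact Set.disjoint_left.1 (hdisj _ _ hne) ⟨_, hσ (l i x)⟩ ⟨x, rfl⟩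
    refine ⟨ha, hinj i ?_⟩
    have h := hσ (l i x)
    rwa [ha] at h
  have key (ψ : X → ℍ[ℝ]) : (∀ i x, ψ (l i x) = qf i x + sf i x * ψ x) ↔
      ∀ y, ψ y = qf (a y) (σ y) + sf (a y) (σ y) * ψ (σ y) := by
    refine ⟨fun h y ↦ ?_, fun h i x ↦ ?_⟩
    · rw [← h, hσ]
    · rw [h, (addr i x).1, (addr i x).2]
  simp only [key]
  refine existsUnique_bounded_eq_add_mul_comp σ (fun y ↦ qf (a y) (σ y))
    (fun y ↦ sf (a y) (σ y)) (M := ∑ i, |M i|) (fun y ↦ ?_) hc (fun y ↦ hs _ _)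
  exact (hM _ _).trans <| (le_abs_self _).trans <|
    Finset.single_le_sum (f := fun i ↦ |M i|) (fun i _ ↦ abs_nonneg _) (Finset.mem_univ (a y))
end
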